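/- arXiv:2405.11095 — 4 statements merged into one kernel-verified Lean document; each statement's English description precedes it below -/
import Mathlib

section
/- Let d ≥ 2 and let g_1, …, g_N ∈ ℝ^d be vectors each of which is 1-sparse (has at most one nonzero coordinate). With sign applied componentwise and the convention sign(s)=1 for s ≥ 0, sign(s)=−1 for s < 0, the vector s = Σ_{n=1}^N sign(g_n) has at most one negative coordinate, and consequently ⟨sign(s), 𝟙⟩ ≥ d − 2 ≥ 0, where 𝟙 ∈ ℝ^d is the all-ones vector. In particular the majority-vote update direction v = sign(Σ_{n=1}^N sign(g_n)) satisfies ⟨v, 𝟙⟩ ≥ 0. -/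
/-- Componentwise sign convention: `sgn s = 1` if `s ≥ 0`, `sgn s = -1` if `s < 0`. -/
noncomputable def sgn (s : ℝ) : ℝ := if 0 ≤ s then 1 else -1

/-- for `d ≥ 2` and 1-sparse vectors `g 1, …, g N ∈ ℝ^d`, the vector
`s = Σ_n sign (g n)` has at most one negative coordinate, hence
`⟨sign s, 𝟙⟩ = ∑ j, sgn (s j) ≥ d - 2 ≥ 0`; in particular the majority-vote direction
`v = sign s` satisfies `⟨v, 𝟙⟩ ≥ 0`. -/
theorem signSGD_majority_vote_halfspace (d N : ℕ) (hd : 2 ≤ d)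
    (g : Fin N → Fin d → ℝ)
    (hsparse : ∀ n : Fin N, ∃ i : Fin d, ∀ j : Fin d, j ≠ i → g n j = 0) :
    Set.Subsingleton {j : Fin d | (∑ n : Fin N, sgn (g n j)) < 0} ∧
      (d : ℝ) - 2 ≤ ∑ j : Fin d, sgn (∑ n : Fin N, sgn (g n j)) ∧
      (0 : ℝ) ≤ (d : ℝ) - 2 ∧
      (0 : ℝ) ≤ ∑ j : Fin d, sgn (∑ n : Fin N, sgn (g n j)) := by
  have hpair : ∀ j k : Fin d, j ≠ k →
      0 ≤ (∑ n : Fin N, sgn (g n j)) + ∑ n : Fin N, sgn (g n k) := by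
    intro j k hjk
    rw [← Finset.sum_add_distrib]
    apply Finset.sum_nonneg
    intro n _
    obtain ⟨i, hi⟩ := hsparse n
    by_cases hj : j = i
    · have hk : g n k = 0 := hi k (fun h => hjk (hj.trans h.symm))
      unfold sgn
      rw [hk]
      split_ifs <;> norm_num at *
    · have hj' : g n j = 0 := hi j hj
      unfold sgn
      rw [hj']
      split_ifs <;> norm_num at *
  have hsub : Set.Subsingleton {j : Fin d | (∑ n : Fin N, sgn (g n j)) < 0} := by
    intro j hj k hk
    by_contra hjk
    have h := hpair j k hjk
    simp only [Set.mem_setOf_eq] at hj hk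
    linarith
  have hd' : (0 : ℝ) ≤ (d : ℝ) - 2 := by
    have : (2 : ℝ) ≤ d := by exact_mod_cast hd
    linarith
  have hmain : (d : ℝ) - 2 ≤ ∑ j : Fin d, sgn (∑ n : Fin N, sgn (g n j)) := by
    obtain ⟨j0, hj0⟩ : ∃ j0 : Fin d, ∀ j, j ≠ j0 → 0 ≤ ∑ n : Fin N, sgn (g n j) := by
      by_cases h : ∃ j0 : Fin d, (∑ n : Fin N, sgn (g n j0)) < 0
      · obtain ⟨j0, h0⟩ := h
        refine ⟨j0, fun j hj => ?_⟩
        by_contra hneg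
        exact hj (hsub (not_le.mp hneg) h0)
      · push Not at h
        exact ⟨⟨0, by omega⟩, fun j _ => h j⟩
    have hle : ∑ j : Fin d, ((1 : ℝ) - if j = j0 then 2 else 0) ≤
        ∑ j : Fin d, sgn (∑ n : Fin N, sgn (g n j)) := by
      apply Finset.sum_le_sum
      intro j _
      by_cases hj : j = j0
      · rw [if_pos hj]
        rw [sgn]
        split_ifs <;> norm_num
      · rw [if_neg hj, sgn, if_pos (hj0 j hj)]
        norm_num
    simpa [Finset.sum_sub_distrib] using hle
  exact ⟨hsub, hmain, hd', hd'.trans hmain⟩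
end

section
/- Let λ > 0, K ∈ ℕ, and let Q_{λ,K} be the K-averaged dithered one-bit quantizer with independent dithers τ_1, …, τ_K uniformly distributed on [−λ,λ]^d. Then for any x ∈ ℝ^d, the vector x − E[Q_{λ,K}(x)] equals the soft-thresholding of x with threshold λ, i.e. its k-th coordinate is sign(x_k)·(|x_k| − λ) if |x_k| > λ and 0 otherwise. -/
open MeasureTheory
open scoped NNReal

/-- The uniform probability measure on the interval `[-lam, lam]`. -/
noncomputable def unifIcc (lam : ℝ) : Measure ℝ :=
  ((Real.toNNReal (2 * lam))⁻¹ : ℝ≥0) • volume.restrict (Set.Icc (-lam) lam)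

instance (lam : ℝ) : IsFiniteMeasure (unifIcc lam) := by
  unfold unifIcc; infer_instance

instance unifIcc_prob (lam : ℝ) [h : Fact (0 < lam)] : IsProbabilityMeasure (unifIcc lam) := by
  have hl := h.out
  constructor
  have h2 : (0:ℝ) < 2 * lam := by linarith
  rw [unifIcc, Measure.smul_apply, Measure.restrict_apply_univ, Real.volume_Icc,
    show lam - -lam = 2 * lam by ring, ENNReal.smul_def, smul_eq_mul, ENNReal.ofReal,
    ← ENNReal.coe_mul, inv_mul_cancel₀ (by simpa using hl)]
  simp

lemma sgn_eq_indicator (a t : ℝ) :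
    sgn (a + t) = 2 * (Set.Ici (-a)).indicator (fun _ => (1:ℝ)) t - 1 := by
  unfold sgn
  by_cases h : 0 ≤ a + t
  · rw [if_pos h, Set.indicator_of_mem (by simp; linarith)]; norm_num
  · rw [if_neg h, Set.indicator_of_notMem (by simp; linarith)]; norm_num

lemma measurable_sgn_add (a : ℝ) : Measurable fun t => sgn (a + t) := by
  simp_rw [sgn_eq_indicator]
  exact ((measurable_const.indicator measurableSet_Ici).const_mul 2).sub_const 1

lemma norm_sgn_le (s : ℝ) : ‖sgn s‖ ≤ 1 := by
  unfold sgn; split_ifs <;> simp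

lemma integral_sgn (lam : ℝ) (hlam : 0 < lam) (a : ℝ) :
    lam * ∫ t, sgn (a + t) ∂(unifIcc lam) = max (lam - max (-lam) (-a)) 0 - lam := by
  have : Fact (0 < lam) := ⟨hlam⟩
  simp_rw [sgn_eq_indicator]
  rw [integral_sub, integral_const_mul, integral_indicator_const _ measurableSet_Ici]
  · have : (unifIcc lam).real (Set.Ici (-a)) = (2 * lam)⁻¹ * max (lam - max (-lam) (-a)) 0 := by
      rw [unifIcc, measureReal_nnreal_smul_apply, measureReal_restrict_apply measurableSet_Ici,
        show Set.Ici (-a) ∩ Set.Icc (-lam) lam = Set.Icc (max (-lam) (-a)) lam by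
          ext t; simp; tauto, Measure.real, Real.volume_Icc, ENNReal.toReal_ofReal']
      congr 1
      rw [NNReal.coe_inv, Real.coe_toNNReal _ (by linarith)]
    rw [this]
    simp
    field_simp
  · exact ((integrable_const (1:ℝ)).indicator measurableSet_Ici).const_mul 2
  · exact integrable_const _

/-- for the `K`-averaged dithered one-bit quantizer
`Q_{λ,K}(x) = (λ/K)·Σ_{i=1}^K sign (x + τ i)` with independent dithers uniformly distributed
on `[−λ,λ]^d`, the vector `x − E[Q_{λ,K}(x)]` equals the soft-thresholding of `x` with
threshold `λ`: its `k`-th coordinate is `sign (x k)·(|x k| − λ)` if `|x k| > λ`, else `0`. -/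
theorem expectation_quantizer_soft_thresholding (d K : ℕ) (hK : 0 < K)
    (lam : ℝ) (hlam : 0 < lam) (x : Fin d → ℝ) :
    ∀ j : Fin d,
      x j - (∫ τ : Fin K → Fin d → ℝ,
          (lam / K) * ∑ i : Fin K, sgn (x j + τ i j)
          ∂(Measure.pi fun _ : Fin K => Measure.pi fun _ : Fin d => unifIcc lam)) =
        if lam < |x j| then sgn (x j) * (|x j| - lam) else 0 := by
  intro j
  have : Fact (0 < lam) := ⟨hlam⟩
  have hmp : ∀ i : Fin K, MeasurePreserving (fun τ : Fin K → Fin d → ℝ => τ i j)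
      (Measure.pi fun _ : Fin K => Measure.pi fun _ : Fin d => unifIcc lam) (unifIcc lam) :=
    fun i => (measurePreserving_eval (fun _ : Fin d => unifIcc lam) j).comp
      (measurePreserving_eval (fun _ : Fin K => Measure.pi fun _ : Fin d => unifIcc lam) i)
  have hint : Integrable (fun t => sgn (x j + t)) (unifIcc lam) :=
    Integrable.of_bound (measurable_sgn_add _).aestronglyMeasurable 1
      (Filter.Eventually.of_forall fun t => norm_sgn_le _)
  have hI : ∀ i : Fin K, ∫ τ : Fin K → Fin d → ℝ, sgn (x j + τ i j)
      ∂(Measure.pi fun _ : Fin K => Measure.pi fun _ : Fin d => unifIcc lam)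
      = ∫ t, sgn (x j + t) ∂(unifIcc lam) := by
    intro i
    have h := integral_map (hmp i).aemeasurable
      (measurable_sgn_add (x j)).aestronglyMeasurable
    rw [(hmp i).map_eq] at h
    exact h.symm
  rw [integral_const_mul, integral_finsetSum]
  swap
  · exact fun i _ => (hmp i).integrable_comp_of_integrable hint
  have hK' : (K : ℝ) ≠ 0 := by positivity
  simp_rw [hI]
  rw [Finset.sum_const, Finset.card_univ, Fintype.card_fin, nsmul_eq_mul, ← mul_assoc,
    div_mul_cancel₀ _ hK', integral_sgn lam hlam]
  unfold sgn
  grind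
end

section
/- Let H_ε = H·D_ε be a randomized universal sensing basis in ℝ^{d times d}. Then for any x ∈ ℝ^d and any α ≥ 2, ‖H_ε·x‖_∞ ≤ α·√(log d / d)·‖x‖ with probability at least 1 − 2·exp(−(1/4)·α²·log d) over the uniform choice of ε ∈ {−1,1}^d, where ‖·‖ is the Euclidean norm and ‖·‖_∞ the sup-norm. -/
open MeasureTheory Matrix

/-- The uniform probability measure on sign patterns `{−1,1}^d`, encoded as the uniform
measure on `Fin d → Bool` (i.e. independent Rademacher coordinates). -/
noncomputable def radMeasure (d : ℕ) : Measure (Fin d → Bool) :=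
  (PMF.uniformOfFintype (Fin d → Bool)).toMeasure

instance (d : ℕ) : IsProbabilityMeasure (radMeasure d) := by
  unfold radMeasure; infer_instance

/-- The `±1` vector associated to a sign pattern. -/
noncomputable def radVec {d : ℕ} (b : Fin d → Bool) : Fin d → ℝ :=
  fun i => if b i then 1 else -1

lemma radMeasure_real_eq (d : ℕ) (p : (Fin d → Bool) → Prop) [DecidablePred p] :
    (radMeasure d).real {b | p b} = ((Finset.univ.filter p).card : ℝ) / 2 ^ d := by
  unfold radMeasure Measure.real
  rw [PMF.toMeasure_uniformOfFintype_apply _ (MeasurableSet.of_discrete)]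
  simp [Fintype.card_subtype]

lemma rad_mgf (d : ℕ) (a : Fin d → ℝ) :
    ∑ b : Fin d → Bool, Real.exp (∑ j, a j * radVec b j) ≤
      2 ^ d * Real.exp ((∑ j, a j ^ 2) / 2) := by
  have h1 : ∑ b : Fin d → Bool, Real.exp (∑ j, a j * radVec b j)
      = ∏ j, ∑ c : Bool, Real.exp (a j * (if c then 1 else -1)) := by
    rw [Finset.prod_univ_sum, Fintype.piFinset_univ]
    simp only [Real.exp_sum, radVec]
  have h2 : (2 : ℝ) ^ d * Real.exp ((∑ j, a j ^ 2) / 2)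
      = ∏ j : Fin d, 2 * Real.exp (a j ^ 2 / 2) := by
    rw [Finset.prod_mul_distrib, Finset.sum_div, Real.exp_sum]
    simp
  rw [h1, h2]
  apply Finset.prod_le_prod
  · intro j _
    positivity
  · intro j _
    have := Real.cosh_le_exp_half_sq (a j)
    rw [Real.cosh_eq] at this
    simp
    linarith

lemma rad_tail (d : ℕ) (a : Fin d → ℝ) (t : ℝ) :
    (radMeasure d).real {b | t < ∑ j, a j * radVec b j} ≤
      Real.exp ((∑ j, a j ^ 2) / 2 - t) := by
  classical
  rw [radMeasure_real_eq, div_le_iff₀ (by positivity), Real.exp_sub, div_mul_eq_mul_div,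
    le_div_iff₀ (Real.exp_pos _), mul_comm (Real.exp _) (2 ^ d : ℝ)]
  refine le_trans ?_ (rad_mgf d a)
  rw [← nsmul_eq_mul, ← Finset.sum_const]
  refine le_trans (Finset.sum_le_sum (g := fun b => Real.exp (∑ j, a j * radVec b j)) ?_) ?_
  · intro b hb
    exact Real.exp_le_exp.2 (Finset.mem_filter.1 hb).2.le
  · exact Finset.sum_le_sum_of_subset_of_nonneg (Finset.filter_subset _ _)
      (fun b _ _ => (Real.exp_pos _).le)

lemma rad_tail_abs (d : ℕ) (a : Fin d → ℝ) (t v : ℝ) (ht : 0 ≤ t) (hv : 0 < v)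
    (ha : ∑ j, a j ^ 2 = v) :
    (radMeasure d).real {b | t < |∑ j, a j * radVec b j|} ≤
      2 * Real.exp (-(t ^ 2 / (2 * v))) := by
  rcases ht.eq_or_lt with rfl | ht
  · have : (radMeasure d).real {b | 0 < |∑ j, a j * radVec b j|} ≤ 1 := measureReal_le_one
    refine this.trans ?_
    norm_num
  have hs : 0 < t / v := div_pos ht hv
  have key : ∀ s : ℝ, s ^ 2 = (t / v) ^ 2 →
      (radMeasure d).real {b | t / v * t < ∑ j, (s * a j) * radVec b j} ≤
        Real.exp (-(t ^ 2 / (2 * v))) := by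
    intro s h
    refine (rad_tail d (fun j => s * a j) (t / v * t)).trans_eq ?_
    congr 1
    simp only [mul_pow, ← Finset.mul_sum, ha, h]
    field_simp
    ring
  have hsub : {b : Fin d → Bool | t < |∑ j, a j * radVec b j|} ⊆
      {b | t / v * t < ∑ j, (t / v * a j) * radVec b j} ∪
      {b | t / v * t < ∑ j, (-(t / v) * a j) * radVec b j} := by
    intro b hb
    simp only [Set.mem_ofPred_eq, Set.mem_union, mul_assoc, ← Finset.mul_sum] at hb ⊢
    rcases lt_abs.1 hb with h | h
    · left; exact mul_lt_mul_of_pos_left h hs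
    · right
      have := mul_lt_mul_of_pos_left h hs
      linarith
  have h1 := key (t / v) rfl
  have h2 := key (-(t / v)) (by ring)
  have h3 := (measureReal_mono (μ := radMeasure d) hsub).trans (measureReal_union_le _ _)
  linarith

/-- for a randomized universal sensing basis `H_ε = H·D_ε` (with `H`
orthonormal, `|H k l| = 1/√d`, and `ε` uniform on `{−1,1}^d`), any `x ∈ ℝ^d` and `α ≥ 2`:
`‖H_ε·x‖_∞ ≤ α·√(log d / d)·‖x‖` with probability at least `1 − 2·exp(−(1/4)·α²·log d)`. -/
theorem flattening_universal_sensing_basis (d : ℕ)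
    (H : Matrix (Fin d) (Fin d) ℝ)
    (hortho : Hᵀ * H = 1)
    (hflat : ∀ k l : Fin d, |H k l| = 1 / Real.sqrt d)
    (x : Fin d → ℝ) (α : ℝ) (hα : 2 ≤ α) :
    ENNReal.ofReal (1 - 2 * Real.exp (-(1 / 4) * α ^ 2 * Real.log d)) ≤
      radMeasure d {b : Fin d → Bool |
        ∀ i : Fin d, |H.mulVec (fun j => radVec b j * x j) i| ≤
          α * Real.sqrt (Real.log d / d) * Real.sqrt (∑ j : Fin d, (x j) ^ 2)} := by
  classical
  rcases Nat.lt_or_ge d 2 with hd | hd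
  · have : Real.log d = 0 := by interval_cases d <;> simp
    rw [this, ENNReal.ofReal_of_nonpos (by simp)]
    exact zero_le
  have hd1 : (1 : ℝ) < d := by exact_mod_cast hd
  have hd0 : (0 : ℝ) < d := by linarith
  have hL : 0 < Real.log d := Real.log_pos hd1
  set X := ∑ j : Fin d, (x j) ^ 2 with hX
  have hX0 : 0 ≤ X := Finset.sum_nonneg (fun j _ => sq_nonneg _)
  set t := α * Real.sqrt (Real.log d / d) * Real.sqrt X with ht
  have ht0 : 0 ≤ t := by positivity
  have hmv : ∀ b i, H.mulVec (fun j => radVec b j * x j) i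
      = ∑ j, (H i j * x j) * radVec b j := by
    intro b i
    simp only [Matrix.mulVec, dotProduct]
    exact Finset.sum_congr rfl (fun j _ => by ring)
  have hsq : ∀ i j, H i j ^ 2 = 1 / d := by
    intro i j
    rw [← sq_abs, hflat, div_pow, Real.sq_sqrt hd0.le, one_pow]
  have hvar : ∀ i, ∑ j, (H i j * x j) ^ 2 = X / d := by
    intro i
    simp only [mul_pow, hsq, ← Finset.mul_sum, ← hX]
    ring
  simp only [hmv]
  have hbad : ∀ i, (radMeasure d).real {b | t < |∑ j, (H i j * x j) * radVec b j|} ≤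
      2 * Real.exp (-(α ^ 2 * Real.log d / 2)) := by
    intro i
    rcases hX0.eq_or_lt with h0 | hpos
    · have hx : ∀ j, x j = 0 := by
        intro j
        have := (Finset.sum_eq_zero_iff_of_nonneg (fun j _ => sq_nonneg (x j))).1 h0.symm j
          (Finset.mem_univ j)
        exact pow_eq_zero_iff (two_ne_zero) |>.1 this
      have : {b : Fin d → Bool | t < |∑ j, (H i j * x j) * radVec b j|} = ∅ := by
        ext b
        simp [hx, ht0]
      rw [this]
      simp
      positivity
    · refine (rad_tail_abs d _ t (X / d) ht0 (by positivity) (hvar i)).trans_eq ?_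
      congr 3
      rw [ht, mul_pow, mul_pow, Real.sq_sqrt hX0, Real.sq_sqrt (by positivity)]
      field_simp
  have hU : (radMeasure d).real (⋃ i, {b | t < |∑ j, (H i j * x j) * radVec b j|}) ≤
      2 * Real.exp (-(1 / 4) * α ^ 2 * Real.log d) := by
    refine (measureReal_iUnion_fintype_le _).trans ?_
    refine (Finset.sum_le_sum (fun i _ => hbad i)).trans ?_
    rw [Finset.sum_const, Finset.card_univ, Fintype.card_fin, nsmul_eq_mul]
    have : (d : ℝ) * Real.exp (-(α ^ 2 * Real.log d / 2)) ≤
        Real.exp (-(1 / 4) * α ^ 2 * Real.log d) := by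
      nth_rewrite 1 [← Real.exp_log hd0]
      rw [← Real.exp_add]
      apply Real.exp_le_exp.2
      have h4 : 4 ≤ α ^ 2 := by nlinarith
      nlinarith
    linarith
  have hc : {b : Fin d → Bool | ∀ i, |∑ j, (H i j * x j) * radVec b j| ≤ t} =
      (⋃ i, {b | t < |∑ j, (H i j * x j) * radVec b j|})ᶜ := by
    ext b
    simp
  rw [hc]
  refine ENNReal.ofReal_le_of_le_toReal ?_
  change _ ≤ (radMeasure d).real _
  rw [probReal_compl_eq_one_sub MeasurableSet.of_discrete]
  linarith
end

section
/- There exists an absolute constant C ≥ 2 such that the following holds. For λ > 0 and K ∈ ℕ, let Z_{λ,K} be a (λ,K)-transform, i.e. Z_{λ,K}(x) = H_ε^{-1} Q_{λ,K}(H_ε x) with ε uniform on {−1,1}^d and K independent dithers uniform on [−λ,λ]^d, all independent. For B > 0 and α ≥ C, set λ = α·B·√(log d / d). Then for any x ∈ ℝ^d with ‖x‖ ≤ B: E[‖Z_{λ,K}(x) − x‖²] ≤ α²·B²·log(d)/K + 8·B²·exp(−(1/8)·α²·log d), where ‖·‖ is the Euclidean norm. -/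
open MeasureTheory Matrix
open scoped NNReal

/-- The `(λ,K)`-transform `Z_{λ,K}(x) = H_ε⁻¹ Q_{λ,K}(H_ε x)` with `H_ε = H·D_ε`,
`H_ε⁻¹ = D_ε·Hᵀ`, given a realization `b` of `ε` and `τ : Fin K → Fin d → ℝ` of the dithers:
`Z_{λ,K}(x) i = ε i · Σ_j H j i · ((λ/K) · Σ_k sign((H_ε x) j + τ k j))`. -/
noncomputable def Ztrans {d : ℕ} (H : Matrix (Fin d) (Fin d) ℝ) (b : Fin d → Bool)
    (lam : ℝ) (K : ℕ) (τ : Fin K → Fin d → ℝ) (x : Fin d → ℝ) : Fin d → ℝ :=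
  fun i => radVec b i * ∑ j : Fin d, H j i *
    ((lam / K) * ∑ k : Fin K, sgn ((∑ l : Fin d, H j l * (radVec b l * x l)) + τ k j))

lemma sgn_eq (y t : ℝ) : sgn (y + t) = 2 * (Set.Ici (-y)).indicator (fun _ => (1:ℝ)) t - 1 := by
  unfold sgn
  by_cases h : 0 ≤ y + t
  · have : t ∈ Set.Ici (-y) := by simp only [Set.mem_Ici]; linarith
    rw [if_pos h, Set.indicator_of_mem this]; norm_num
  · have : t ∉ Set.Ici (-y) := by simp only [Set.mem_Ici]; intro h'; apply h; linarith
    rw [if_neg h, Set.indicator_of_notMem this]; norm_num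

lemma sgn_sq (s : ℝ) : sgn s ^ 2 = 1 := by
  unfold sgn; split_ifs <;> norm_num

lemma measurable_sgn : Measurable sgn := by
  unfold sgn
  exact Measurable.ite measurableSet_Ici measurable_const measurable_const

lemma unif_prob (lam : ℝ) (h : 0 < lam) : IsProbabilityMeasure (unifIcc lam) := by
  constructor
  unfold unifIcc
  rw [Measure.smul_apply, Measure.restrict_apply MeasurableSet.univ, Set.univ_inter,
    Real.volume_Icc, ENNReal.smul_def, smul_eq_mul, show lam - -lam = 2 * lam by ring,
    ENNReal.ofReal, ← ENNReal.coe_mul, inv_mul_cancel₀]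
  · rfl
  · simp [h]

lemma unif_real_Ici (lam y : ℝ) (h : 0 < lam) :
    (unifIcc lam).real (Set.Ici (-y)) = (2 * lam)⁻¹ * max (lam - max (-lam) (-y)) 0 := by
  unfold unifIcc
  rw [measureReal_nnreal_smul_apply, measureReal_restrict_apply measurableSet_Ici]
  have : Set.Ici (-y) ∩ Set.Icc (-lam) lam = Set.Icc (max (-lam) (-y)) lam := by
    ext t; simp only [Set.mem_inter_iff, Set.mem_Ici, Set.mem_Icc, max_le_iff]; tauto
  rw [this, Measure.real, Real.volume_Icc, ENNReal.toReal_ofReal', NNReal.coe_inv,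
    Real.coe_toNNReal _ (by linarith)]

lemma mean_sgn (lam y : ℝ) (h : 0 < lam) :
    lam * ∫ t, sgn (y + t) ∂(unifIcc lam) = max (lam - max (-lam) (-y)) 0 - lam := by
  have := unif_prob lam h
  simp only [sgn_eq]
  rw [integral_sub, integral_const_mul, integral_indicator measurableSet_Ici]
  · simp only [integral_const, smul_eq_mul, mul_one, measureReal_restrict_apply_univ,
      probReal_univ, unif_real_Ici lam y h]
    field_simp
  · exact (((integrable_const (1:ℝ)).indicator measurableSet_Ici).const_mul 2)
  · exact integrable_const _

lemma bias_bound (lam y s : ℝ) (h : 0 < lam) (hs : 0 < s) :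
    (max (lam - max (-lam) (-y)) 0 - lam - y) ^ 2 ≤
      2 / s ^ 2 * Real.exp (-(s * lam)) * (Real.exp (s * y) + Real.exp (-(s * y))) := by
  have key : ∀ u : ℝ, 0 ≤ u → u ^ 2 ≤ 2 / s ^ 2 * Real.exp (s * u) := by
    intro u hu
    have h1 := Real.quadratic_le_exp_of_nonneg (mul_nonneg hs.le hu)
    have : u ^ 2 = 2 / s ^ 2 * ((s * u) ^ 2 / 2) := by field_simp
    rw [this]
    apply mul_le_mul_of_nonneg_left _ (by positivity)
    have := mul_nonneg hs.le hu
    linarith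
  have e : 2 / s ^ 2 * Real.exp (-(s * lam)) * (Real.exp (s * y) + Real.exp (-(s * y))) =
     2 / s ^ 2 * Real.exp (s * (y - lam)) + 2 / s ^ 2 * Real.exp (s * (-y - lam)) := by
    rw [show s * (y - lam) = -(s * lam) + s * y by ring,
      show s * (-y - lam) = -(s * lam) + -(s * y) by ring, Real.exp_add, Real.exp_add]
    ring
  rw [e]
  have p1 : 0 ≤ 2 / s ^ 2 * Real.exp (s * (y - lam)) := by positivity
  have p2 : 0 ≤ 2 / s ^ 2 * Real.exp (s * (-y - lam)) := by positivity
  rcases le_total y lam with h1 | h1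
  · rcases le_total (-lam) y with h2 | h2
    · rw [max_eq_right (by linarith : -lam ≤ -y), max_eq_left (by linarith)]
      have : lam - -y - lam - y = 0 := by ring
      rw [this]; nlinarith
    · rw [max_eq_right (by linarith : -lam ≤ -y), max_eq_right (by linarith)]
      have := key (-y - lam) (by linarith)
      nlinarith
  · rw [max_eq_left (by linarith : -y ≤ -lam), max_eq_left (by linarith)]
    have := key (y - lam) (by linarith)
    nlinarith

/-- mean square error of one coordinate -/
lemma coord_mse (d K : ℕ) (hK : 0 < K) (lam y : ℝ) (h : 0 < lam) (j : Fin d) :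
    ∫ τ, ((lam / K) * ∑ k : Fin K, sgn (y + τ k j) - y) ^ 2
      ∂(Measure.pi fun _ : Fin K => Measure.pi fun _ : Fin d => unifIcc lam) ≤
    lam ^ 2 / K + (max (lam - max (-lam) (-y)) 0 - lam - y) ^ 2 := by
  have := unif_prob lam h
  set ν : Measure (Fin d → ℝ) := Measure.pi fun _ : Fin d => unifIcc lam with hν
  set P : Measure (Fin K → Fin d → ℝ) := Measure.pi fun _ : Fin K => ν with hP
  let g : (Fin d → ℝ) → ℝ := fun v => sgn (y + v j)
  have hg : Measurable g := measurable_sgn.comp (by fun_prop)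
  let X : Fin K → (Fin K → Fin d → ℝ) → ℝ := fun k τ => g (τ k)
  have hXm : ∀ k, Measurable (X k) := fun k => hg.comp (measurable_pi_apply k)
  have hXb : ∀ k τ, ‖X k τ‖ ≤ 1 := by
    intro k τ
    show ‖sgn _‖ ≤ 1
    unfold sgn; split_ifs <;> simp
  have hXL : ∀ k, MemLp (X k) 2 P := fun k =>
    MemLp.of_bound (hXm k).aestronglyMeasurable 1 (Filter.Eventually.of_forall (hXb k))
  have hind : ProbabilityTheory.iIndepFun X P :=
    ProbabilityTheory.iIndepFun_pi (X := fun _ => g) (fun _ => hg.aemeasurable)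
  have hmean : ∀ k, lam * ∫ τ, X k τ ∂P = max (lam - max (-lam) (-y)) 0 - lam := by
    intro k
    rw [← mean_sgn lam y h]
    congr 1
    have e1 := (measurePreserving_eval (fun _ : Fin K => ν) k)
    have e2 := (measurePreserving_eval (fun _ : Fin d => unifIcc lam) j)
    have i1 : ∫ τ, X k τ ∂P = ∫ v, g v ∂ν := by
      rw [← e1.map_eq, integral_map e1.measurable.aemeasurable hg.aestronglyMeasurable]
    rw [i1, ← e2.map_eq, integral_map e2.measurable.aemeasurable]
    exact (measurable_sgn.comp (measurable_id.const_add y)).aestronglyMeasurable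
  have hvar : ∀ k, ProbabilityTheory.variance (X k) P ≤ 1 := by
    intro k
    refine (ProbabilityTheory.variance_le_expectation_sq (hXm k).aestronglyMeasurable).trans ?_
    have : (X k) ^ 2 = fun _ => (1:ℝ) := by
      ext τ; exact sgn_sq _
    rw [this]; simp
  let S : (Fin K → Fin d → ℝ) → ℝ := ∑ k, X k
  have hSL : MemLp S 2 P := memLp_finsetSum' _ (fun k _ => hXL k)
  have hSv : ProbabilityTheory.variance S P ≤ K := by
    have := ProbabilityTheory.IndepFun.variance_sum (X := X) (s := Finset.univ) (μ := P)
      (fun k _ => hXL k) (fun i _ k _ hik => hind.indepFun hik)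
    show ProbabilityTheory.variance (∑ k, X k) P ≤ K
    rw [this]
    refine (Finset.sum_le_sum (fun k _ => hvar k)).trans ?_
    simp
  let W : (Fin K → Fin d → ℝ) → ℝ := fun τ => (lam / K) * S τ - y
  have hK' : (0:ℝ) < K := by exact_mod_cast hK
  have hWL : MemLp W 2 P := (hSL.const_mul (lam / K)).sub (memLp_const y)
  have hWv : ProbabilityTheory.variance W P ≤ lam ^ 2 / K := by
    show ProbabilityTheory.variance (fun τ => (lam / K) * S τ - y) P ≤ _
    rw [ProbabilityTheory.variance_sub_const (hSL.const_mul (lam / K)).aestronglyMeasurable,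
      ProbabilityTheory.variance_const_mul]
    calc (lam / K) ^ 2 * ProbabilityTheory.variance S P ≤ (lam / K) ^ 2 * K := by gcongr
      _ = lam ^ 2 / K := by field_simp
  have hSi : ∫ τ, S τ ∂P = ∑ k, ∫ τ, X k τ ∂P := by
    rw [← integral_finsetSum _ (fun k _ => (hXL k).integrable (by norm_num))]
    simp [S]
  have hWm : ∫ τ, W τ ∂P = max (lam - max (-lam) (-y)) 0 - lam - y := by
    show ∫ τ, ((lam / K) * S τ - y) ∂P = _
    rw [integral_sub ((hSL.integrable (by norm_num)).const_mul _) (integrable_const _),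
      integral_const_mul, hSi]
    have : (lam / K) * ∑ k, ∫ τ, X k τ ∂P = max (lam - max (-lam) (-y)) 0 - lam := by
      rw [div_mul_eq_mul_div, Finset.mul_sum, Finset.sum_congr rfl (fun k _ => hmean k)]
      simp; field_simp
    rw [this]; simp
  have hfin := ProbabilityTheory.variance_eq_sub hWL
  rw [hWm] at hfin
  have : ∫ τ, ((lam / K) * ∑ k : Fin K, sgn (y + τ k j) - y) ^ 2 ∂P = ∫ τ, (W ^ 2) τ ∂P := by
    congr 1; ext τ; simp [W, S, X, g]
  rw [this]
  linarith

lemma mgf_bound (d : ℕ) (a : Fin d → ℝ) :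
    ∫ b, Real.exp (∑ l, a l * radVec b l) ∂(radMeasure d) ≤ Real.exp ((∑ l, a l ^ 2) / 2) := by
  have h1 : ∫ b, Real.exp (∑ l, a l * radVec b l) ∂(radMeasure d) = ∏ l, Real.cosh (a l) := by
    unfold radMeasure
    rw [PMF.integral_eq_sum]
    simp only [PMF.uniformOfFintype_apply, smul_eq_mul, Real.exp_sum, radVec]
    rw [← Finset.mul_sum]
    have := Finset.prod_univ_sum (fun _ : Fin d => (Finset.univ : Finset Bool))
      (fun l c => Real.exp (a l * if c then 1 else -1))
    rw [Fintype.piFinset_univ] at this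
    rw [← this]
    simp only [Fintype.sum_bool, Real.cosh_eq, Finset.prod_div_distrib]
    simp [div_eq_inv_mul]
  rw [h1, Finset.sum_div, Real.exp_sum]
  exact Finset.prod_le_prod (fun l _ => (Real.cosh_pos _).le) (fun l _ => Real.cosh_le_exp_half_sq _)

lemma norm_ident (d K : ℕ) (H : Matrix (Fin d) (Fin d) ℝ) (hH : Hᵀ * H = 1) (b : Fin d → Bool)
    (lam : ℝ) (τ : Fin K → Fin d → ℝ) (x : Fin d → ℝ) :
    ∑ i, (Ztrans H b lam K τ x i - x i) ^ 2 =
    ∑ j, ((lam / K) * ∑ k : Fin K, sgn ((∑ l : Fin d, H j l * (radVec b l * x l)) + τ k j)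
      - ∑ l : Fin d, H j l * (radVec b l * x l)) ^ 2 := by
  have hH' : H * Hᵀ = 1 := mul_eq_one_comm.mp hH
  set y : Fin d → ℝ := H *ᵥ (fun l => radVec b l * x l) with hy
  have hyj : ∀ j, ∑ l : Fin d, H j l * (radVec b l * x l) = y j := fun j => rfl
  have hr : ∀ i, radVec b i * radVec b i = 1 := by
    intro i; unfold radVec; split_ifs <;> norm_num
  unfold Ztrans
  simp only [hyj]
  set q : Fin d → ℝ := fun j => (lam / K) * ∑ k : Fin K, sgn (y j + τ k j) with hq
  have hyinv : Hᵀ *ᵥ y = fun l => radVec b l * x l := by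
    rw [hy, Matrix.mulVec_mulVec, hH, Matrix.one_mulVec]
  have hz : ∀ i, radVec b i * ∑ j, H j i * q j - x i = radVec b i * (Hᵀ *ᵥ (q - y)) i := by
    intro i
    rw [Matrix.mulVec_sub, hyinv]
    show _ = radVec b i * (∑ j, H j i * q j - radVec b i * x i)
    linear_combination (x i) * hr i
  have e1 : ∑ i, (radVec b i * ∑ j, H j i * q j - x i) ^ 2 =
      (Hᵀ *ᵥ (q - y)) ⬝ᵥ (Hᵀ *ᵥ (q - y)) := by
    unfold dotProduct
    refine Finset.sum_congr rfl (fun i _ => ?_)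
    rw [hz i]
    linear_combination ((Hᵀ *ᵥ (q - y)) i) ^ 2 * hr i
  have e2 : (Hᵀ *ᵥ (q - y)) ⬝ᵥ (Hᵀ *ᵥ (q - y)) = (q - y) ⬝ᵥ (q - y) := by
    rw [Matrix.dotProduct_mulVec, Matrix.vecMul_transpose, Matrix.mulVec_mulVec, hH',
      Matrix.one_mulVec]
  refine (e1.trans e2).trans ?_
  unfold dotProduct
  exact Finset.sum_congr rfl (fun i _ => (sq _).symm)

lemma rad_integrable (d : ℕ) (f : (Fin d → Bool) → ℝ) : Integrable f (radMeasure d) :=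
  Integrable.of_finite

lemma exp_avg (d : ℕ) (H : Matrix (Fin d) (Fin d) ℝ)
    (hE : ∀ k l : Fin d, |H k l| = 1 / Real.sqrt d) (B : ℝ)
    (x : Fin d → ℝ) (hx : ∑ j, (x j) ^ 2 ≤ B ^ 2) (j : Fin d) (s : ℝ) :
    ∫ b, Real.exp (s * ∑ l : Fin d, H j l * (radVec b l * x l)) ∂(radMeasure d) ≤
      Real.exp (s ^ 2 * (B ^ 2 / d) / 2) := by
  have h := mgf_bound d (fun l => s * H j l * x l)
  have e : ∀ b : Fin d → Bool, s * ∑ l : Fin d, H j l * (radVec b l * x l)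
      = ∑ l, (s * H j l * x l) * radVec b l := by
    intro b; rw [Finset.mul_sum]; exact Finset.sum_congr rfl (fun l _ => by ring)
  simp only [e]
  refine h.trans (Real.exp_le_exp.mpr ?_)
  have hsq : ∀ l, (s * H j l * x l) ^ 2 = s ^ 2 / d * (x l) ^ 2 := by
    intro l
    have : (H j l) ^ 2 = 1 / d := by
      rw [← sq_abs, hE, div_pow, one_pow, Real.sq_sqrt (Nat.cast_nonneg d)]
    rw [mul_pow, mul_pow, this]; ring
  simp only [hsq]
  rw [← Finset.mul_sum]
  have : s ^ 2 / d * ∑ l, (x l) ^ 2 ≤ s ^ 2 / d * B ^ 2 := by gcongr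
  calc _ ≤ s ^ 2 / d * B ^ 2 / 2 := by linarith
    _ = _ := by ring

lemma bias_avg (d : ℕ) (hd : 2 ≤ d) (H : Matrix (Fin d) (Fin d) ℝ)
    (hE : ∀ k l : Fin d, |H k l| = 1 / Real.sqrt d) (B α lam : ℝ) (hB : 0 < B) (hα : 2 ≤ α)
    (hlam : lam = α * B * Real.sqrt (Real.log d / d))
    (x : Fin d → ℝ) (hx : ∑ j, (x j) ^ 2 ≤ B ^ 2) (j : Fin d) :
    ∫ b, (max (lam - max (-lam) (-(∑ l : Fin d, H j l * (radVec b l * x l)))) 0 - lam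
        - (∑ l : Fin d, H j l * (radVec b l * x l))) ^ 2 ∂(radMeasure d) ≤
      8 * B ^ 2 * Real.exp (-(1 / 8) * α ^ 2 * Real.log d) / d := by
  have hd0 : (0:ℝ) < d := by positivity
  have hd2 : (2:ℝ) ≤ d := by exact_mod_cast hd
  have hL : 0.69 < Real.log d :=
    lt_of_lt_of_le (by linarith [Real.log_two_gt_d9]) (Real.log_le_log (by norm_num) hd2)
  have hlam2 : lam ^ 2 = α ^ 2 * B ^ 2 * (Real.log d / d) := by
    rw [hlam, mul_pow, mul_pow, Real.sq_sqrt (by positivity)]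
  have hl0 : 0 < lam := by
    rw [hlam]
    have : 0 < Real.log d / d := by positivity
    positivity
  set s : ℝ := lam * d / B ^ 2 with hs
  have hs0 : 0 < s := by positivity
  have a1 : s * lam = α ^ 2 * Real.log d := by
    rw [hs, show lam * d / B ^ 2 * lam = lam ^ 2 * d / B ^ 2 by ring, hlam2]
    field_simp
  have a2 : s ^ 2 * (B ^ 2 / d) = α ^ 2 * Real.log d := by
    rw [← a1, hs]; field_simp
  have a3 : s ^ 2 = α ^ 2 * Real.log d * d / B ^ 2 := by
    rw [← a2]; field_simp
  set M : ℝ := α ^ 2 * Real.log d with hM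
  have hM1 : 1 ≤ M := by rw [hM]; nlinarith
  have step : ∫ b, (max (lam - max (-lam) (-(∑ l : Fin d, H j l * (radVec b l * x l)))) 0 - lam
        - (∑ l : Fin d, H j l * (radVec b l * x l))) ^ 2 ∂(radMeasure d) ≤
      ∫ b, 2 / s ^ 2 * Real.exp (-(s * lam)) *
        (Real.exp (s * ∑ l : Fin d, H j l * (radVec b l * x l)) +
          Real.exp ((-s) * ∑ l : Fin d, H j l * (radVec b l * x l))) ∂(radMeasure d) := by
    refine integral_mono (rad_integrable d _) (rad_integrable d _) (fun b => ?_)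
    have := bias_bound lam (∑ l : Fin d, H j l * (radVec b l * x l)) s hl0 hs0
    simpa only [neg_mul] using this
  refine step.trans ?_
  rw [integral_const_mul, integral_add (rad_integrable d _) (rad_integrable d _)]
  have b1 := exp_avg d H hE B x hx j s
  have b2 := exp_avg d H hE B x hx j (-s)
  rw [neg_sq] at b2
  rw [a2] at b1 b2
  rw [a1]
  calc _ ≤ 2 / s ^ 2 * Real.exp (-M) * (Real.exp (M / 2) + Real.exp (M / 2)) := by gcongr
    _ = 4 * (B ^ 2 / d) / M * Real.exp (-(M / 2)) := by
      rw [a3, show -(M / 2) = -M + M / 2 by ring, Real.exp_add]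
      field_simp; ring
    _ ≤ 8 * (B ^ 2 / d) * Real.exp (-(1 / 8) * M) := by
      apply mul_le_mul _ (Real.exp_le_exp.mpr (by linarith)) (Real.exp_pos _).le (by positivity)
      rw [div_le_iff₀ (by linarith)]
      have : 0 < B ^ 2 / d := by positivity
      nlinarith
    _ = _ := by rw [hM]; ring_nf

lemma measurable_coord (d K : ℕ) (lam y : ℝ) (j : Fin d) :
    Measurable (fun τ : Fin K → Fin d → ℝ =>
      ((lam / K) * ∑ k : Fin K, sgn (y + τ k j) - y) ^ 2) := by
  have : ∀ k : Fin K, Measurable (fun τ : Fin K → Fin d → ℝ => sgn (y + τ k j)) := fun k =>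
    measurable_sgn.comp (by fun_prop)
  exact (((Finset.measurable_fun_sum _ (fun k _ => this k)).const_mul _).sub_const _).pow_const _

lemma coord_bound (K : ℕ) (lam y : ℝ) (t : Fin K → ℝ) :
    ‖((lam / K) * ∑ k : Fin K, sgn (y + t k) - y) ^ 2‖ ≤ (|lam / K| * K + |y|) ^ 2 := by
  rw [norm_pow, Real.norm_eq_abs]
  gcongr
  refine (abs_sub _ _).trans ?_
  rw [abs_mul]
  gcongr
  refine (Finset.abs_sum_le_sum_abs _ _).trans ?_
  have : ∀ k : Fin K, |sgn (y + t k)| ≤ 1 := by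
    intro k; unfold sgn; split_ifs <;> simp
  refine (Finset.sum_le_sum (fun k _ => this k)).trans ?_
  simp

theorem lambda_K_transform_error : ∃ C : ℝ, 2 ≤ C ∧
    ∀ (d K : ℕ), 0 < K →
      ∀ (H : Matrix (Fin d) (Fin d) ℝ),
        Hᵀ * H = 1 → (∀ k l : Fin d, |H k l| = 1 / Real.sqrt d) →
        ∀ (B α : ℝ), 0 < B → C ≤ α →
        ∀ x : Fin d → ℝ, Real.sqrt (∑ j : Fin d, (x j) ^ 2) ≤ B →
        (let lam := α * B * Real.sqrt (Real.log d / d)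
         let μ : Measure ((Fin d → Bool) × (Fin K → Fin d → ℝ)) :=
           (radMeasure d).prod
             (Measure.pi fun _ : Fin K => Measure.pi fun _ : Fin d => unifIcc lam)
         (∫ ω, ∑ i : Fin d, (Ztrans H ω.1 lam K ω.2 x i - x i) ^ 2 ∂μ) ≤
           α ^ 2 * B ^ 2 * Real.log d / K +
             8 * B ^ 2 * Real.exp (-(1 / 8) * α ^ 2 * Real.log d)) := by
  refine ⟨2, le_refl _, ?_⟩
  intro d K hK H hH hE B α hB hα x hx
  have hx2 : ∑ j, (x j) ^ 2 ≤ B ^ 2 := (Real.sqrt_le_left hB.le).mp hx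
  intro lam μ
  rcases Nat.lt_or_ge d 2 with hd | hd
  · have hlog : 0 ≤ Real.log d := Real.log_natCast_nonneg d
    have hR : 0 ≤ α ^ 2 * B ^ 2 * Real.log d / K +
             8 * B ^ 2 * Real.exp (-(1 / 8) * α ^ 2 * Real.log d) := by positivity
    refine le_of_eq_of_le ?_ hR
    have hlam : lam = 0 := by
      have : d = 0 ∨ d = 1 := by omega
      simp only [lam]
      rcases this with h | h <;> rw [h] <;> simp
    interval_cases d
    · simp
    · have hμ : μ = 0 := by
        have : Nonempty (Fin K) := ⟨⟨0, hK⟩⟩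
        have h0 : unifIcc lam = 0 := by rw [hlam]; unfold unifIcc; simp
        have h1 : (Measure.pi fun _ : Fin 1 => unifIcc lam) = 0 := by
          rw [← Measure.measure_univ_eq_zero, Measure.pi_univ, h0]; simp
        have h2 : (Measure.pi fun _ : Fin K => Measure.pi fun _ : Fin 1 => unifIcc lam) = 0 := by
          rw [← Measure.measure_univ_eq_zero, Measure.pi_univ, h1]; simp [hK.ne']
        simp only [μ]
        rw [h2, Measure.prod_zero]
      rw [hμ, integral_zero_measure]
  have hd0 : (0:ℝ) < d := by positivity
  have hd2 : (2:ℝ) ≤ d := by exact_mod_cast hd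
  have hL : 0 < Real.log d := Real.log_pos (by linarith)
  have hl0 : 0 < lam := by
    have : 0 < Real.log d / d := by positivity
    have : 0 < α := by linarith
    simp only [lam]
    positivity
  have := unif_prob lam hl0
  let y : (Fin d → Bool) → Fin d → ℝ := fun b j => ∑ l : Fin d, H j l * (radVec b l * x l)
  let P : Measure (Fin K → Fin d → ℝ) :=
    Measure.pi fun _ : Fin K => Measure.pi fun _ : Fin d => unifIcc lam
  let F : (Fin d → Bool) → (Fin K → Fin d → ℝ) → Fin d → ℝ := fun b τ j =>
    ((lam / K) * ∑ k : Fin K, sgn (y b j + τ k j) - y b j) ^ 2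
  have hint : ∀ b j, Integrable (fun τ => F b τ j) P := by
    intro b j
    refine Integrable.of_bound (measurable_coord d K lam (y b j) j).aestronglyMeasurable
      ((|lam / K| * K + |y b j|) ^ 2) (Filter.Eventually.of_forall (fun τ => ?_))
    exact coord_bound K lam (y b j) (fun k => τ k j)
  have hint2 : Integrable (fun ω : (Fin d → Bool) × (Fin K → Fin d → ℝ) => ∑ j, F ω.1 ω.2 j) μ := by
    refine integrable_finsetSum _ (fun j _ => ?_)
    refine (integrable_prod_iff ?_).mpr ⟨?_, rad_integrable d _⟩
    · refine Measurable.aestronglyMeasurable ?_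
      exact measurable_from_prod_countable_right (fun b => measurable_coord d K lam (y b j) j)
    · exact Filter.Eventually.of_forall (fun b => hint b j)
  have e1 : (∫ ω, ∑ i : Fin d, (Ztrans H ω.1 lam K ω.2 x i - x i) ^ 2 ∂μ) =
      ∫ b, ∑ j, ∫ τ, F b τ j ∂P ∂(radMeasure d) := by
    simp only [norm_ident d K H hH]
    refine (integral_prod _ hint2).trans ?_
    congr 1; ext b
    exact integral_finsetSum _ (fun j _ => hint b j)
  rw [e1]
  have e2 : ∫ b, ∑ j, ∫ τ, F b τ j ∂P ∂(radMeasure d) ≤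
      ∫ b, ∑ j, (lam ^ 2 / K + (max (lam - max (-lam) (-(y b j))) 0 - lam - y b j) ^ 2)
        ∂(radMeasure d) := by
    refine integral_mono (rad_integrable d _) (rad_integrable d _) (fun b => ?_)
    exact Finset.sum_le_sum (fun j _ => coord_mse d K hK lam (y b j) hl0 j)
  refine e2.trans ?_
  rw [integral_finsetSum _ (fun j _ => rad_integrable d _)]
  have e3 : ∀ j : Fin d, ∫ b, (lam ^ 2 / K + (max (lam - max (-lam) (-(y b j))) 0 - lam - y b j) ^ 2)
        ∂(radMeasure d) ≤ lam ^ 2 / K + 8 * B ^ 2 * Real.exp (-(1 / 8) * α ^ 2 * Real.log d) / d := by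
    intro j
    rw [integral_add (rad_integrable d _) (rad_integrable d _)]
    have := bias_avg d hd H hE B α lam hB hα rfl x hx2 j
    simpa using this
  refine (Finset.sum_le_sum (fun j _ => e3 j)).trans ?_
  have hlam2 : lam ^ 2 = α ^ 2 * B ^ 2 * (Real.log d / d) := by
    simp only [lam]
    rw [mul_pow, mul_pow, Real.sq_sqrt (by positivity)]
  rw [Finset.sum_const, Finset.card_univ, Fintype.card_fin, nsmul_eq_mul, hlam2]
  apply le_of_eq
  have : (K:ℝ) ≠ 0 := by positivity
  field_simp
end
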